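/- Let k = |B|^t − |B|^{t−1}, let α*, ᾱ, α' ∈ F be three distinct elements, and let w ∈ F satisfy Tr_{F/B}(wα*) = Tr_{F/B}(wᾱ) = Tr_{F/B}(wα'). Then p_{w,α*}(ᾱ) = 0 and p_{w,α*}(α') = 0, and for every polynomial f ∈ F[x] with deg f ≤ k − 1 the repair equation avoiding both ᾱ and α' holds: Tr_{F/B}(w·f(α*)) = − Σ_{α ∈ F \ {α*, ᾱ, α'}} Tr_{F/B}(w(α − α*)) · Tr_{F/B}(f(α)/(α − α*)). -/

import Mathlib

open Polynomial

/-- The field trace `Tr_{F/B}(x) = ∑_{i=0}^{t-1} x^{q^i}` (with `q = |B|`). -/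
noncomputable def fTr (q t : ℕ) {F : Type*} [Field F] (x : F) : F :=
  ∑ i ∈ Finset.range t, x ^ q ^ i

/-- The check polynomial `p_{u,α}(x) = ∑_{i=0}^{t-1} u^{q^i} (x - α)^{q^i - 1}`. -/
noncomputable def pPoly (q t : ℕ) {F : Type*} [Field F] (u α : F) : Polynomial F :=
  ∑ i ∈ Finset.range t, Polynomial.C (u ^ q ^ i) * (Polynomial.X - Polynomial.C α) ^ (q ^ i - 1)

theorem fTr_eq_algebraMap_trace {B F : Type*} [Field B] [Field F] [Algebra B F] [Fintype B]
    [Finite F] (x : F) :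
    fTr (Fintype.card B) (Module.finrank B F) x = algebraMap B F (Algebra.trace B F x) := by
  rw [FiniteField.algebraMap_trace_eq_sum_pow, Nat.card_eq_fintype_card, fTr]

theorem eval_pPoly_mul_sub (q t : ℕ) (hq : 0 < q) {F : Type*} [Field F] (u α β : F) :
    (pPoly q t u α).eval β * (β - α) = fTr q t (u * (β - α)) := by
  simp only [pPoly, fTr, eval_finsetSum, Finset.sum_mul]
  refine Finset.sum_congr rfl fun i _ ↦ ?_
  simp only [eval_mul, eval_C, eval_pow, eval_sub, eval_X]
  rw [mul_assoc, pow_sub_one_mul (pow_pos hq i).ne', mul_pow]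

theorem eval_pPoly_self (q t : ℕ) (hq : 1 < q) (ht : 0 < t) {F : Type*} [Field F] (u α : F) :
    (pPoly q t u α).eval α = u := by
  simp only [pPoly, eval_finsetSum]
  rw [Finset.sum_eq_single 0]
  · simp
  · intro i _ hi
    have := Nat.one_lt_pow hi hq
    simp [zero_pow (show q ^ i - 1 ≠ 0 by omega)]
  · intro h
    simp [ht.ne'] at h

theorem natDegree_pPoly_le (q t : ℕ) (hq : 0 < q) {F : Type*} [Field F] (u α : F) :
    (pPoly q t u α).natDegree ≤ q ^ (t - 1) - 1 := by
  refine natDegree_sum_le_of_forall_le _ _ fun i hi ↦ ?_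
  have hi' : i ≤ t - 1 := by have := Finset.mem_range.1 hi; omega
  refine (natDegree_C_mul_le _ _).trans ?_
  rw [natDegree_pow, natDegree_X_sub_C, mul_one]
  exact Nat.sub_le_sub_right (Nat.pow_le_pow_right hq hi') 1

theorem sum_eval_eq_zero_of_natDegree_lt {F : Type*} [Field F] [Fintype F] (g : Polynomial F)
    (hg : g.natDegree < Fintype.card F - 1) : ∑ x : F, g.eval x = 0 := by
  simp only [eval_eq_sum_range]
  rw [Finset.sum_comm]
  refine Finset.sum_eq_zero fun i hi ↦ ?_
  rw [← Finset.mul_sum, FiniteField.sum_pow_lt_card_sub_one, mul_zero]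
  have := Finset.mem_range.1 hi
  omega

/-- With `k = |B|^t - |B|^{t-1}`, three distinct `α*, ᾱ, α' ∈ F`, and `w ∈ F` with
`Tr(wα*) = Tr(wᾱ) = Tr(wα')`: one has `p_{w,α*}(ᾱ) = 0`, `p_{w,α*}(α') = 0`, and for
every `f` with `deg f ≤ k - 1` the repair equation avoiding both `ᾱ` and `α'` holds:
`Tr(w·f(α*)) = - ∑_{α ∉ {α*, ᾱ, α'}} Tr(w(α-α*)) · Tr(f(α)/(α-α*))`. -/
theorem stmt14 (p m t : ℕ) (hp : p.Prime) (hm : 0 < m) (ht : 0 < t)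
    (B F : Type*) [Field B] [Field F] [Algebra B F] [Fintype B] [Fintype F] [DecidableEq F]
    (hB : Fintype.card B = p ^ m) (hF : Fintype.card F = Fintype.card B ^ t)
    (k : ℕ) (hk : k = Fintype.card B ^ t - Fintype.card B ^ (t - 1))
    (αs αb αp : F) (h1 : αs ≠ αb) (h2 : αb ≠ αp) (h3 : αs ≠ αp)
    (w : F)
    (hw1 : fTr (Fintype.card B) t (w * αs) = fTr (Fintype.card B) t (w * αb))
    (hw2 : fTr (Fintype.card B) t (w * αb) = fTr (Fintype.card B) t (w * αp)) :
    (pPoly (Fintype.card B) t w αs).eval αb = 0 ∧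
    (pPoly (Fintype.card B) t w αs).eval αp = 0 ∧
    ∀ f : Polynomial F, f.degree ≤ ((k - 1 : ℕ) : WithBot ℕ) →
      fTr (Fintype.card B) t (w * f.eval αs)
        = - ∑ α ∈ (Finset.univ : Finset F) \ {αs, αb, αp},
            fTr (Fintype.card B) t (w * (α - αs))
              * fTr (Fintype.card B) t (f.eval α / (α - αs)) := by
  have hq : 1 < Fintype.card B := Fintype.one_lt_card
  have hfin : t = Module.finrank B F :=
    Nat.pow_right_injective hq (hF.symm.trans Module.card_eq_pow_finrank)
  have htr (x : F) : fTr (Fintype.card B) t x = algebraMap B F (Algebra.trace B F x) := by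
    rw [hfin, fTr_eq_algebraMap_trace]
  have htr_sub (x : F) (hx : fTr (Fintype.card B) t (w * αs) = fTr (Fintype.card B) t (w * x)) :
      fTr (Fintype.card B) t (w * (x - αs)) = 0 := by
    rw [htr, htr] at hx
    rw [htr, mul_sub, map_sub, map_sub, hx, sub_self]
  have hroot (x : F) (hne : αs ≠ x)
      (hx : fTr (Fintype.card B) t (w * αs) = fTr (Fintype.card B) t (w * x)) :
      (pPoly (Fintype.card B) t w αs).eval x = 0 := by
    have h := eval_pPoly_mul_sub (Fintype.card B) t hq.le w αs x
    rw [htr_sub x hx] at h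
    exact (mul_eq_zero.1 h).resolve_right (sub_ne_zero.2 hne.symm)
  have hb := hroot αb h1 hw1
  have hp' := hroot αp h3 (hw1.trans hw2)
  refine ⟨hb, hp', fun f hf ↦ ?_⟩
  have hpow : Fintype.card B ^ (t - 1) < Fintype.card B ^ t := Nat.pow_lt_pow_right hq (by omega)
  have hpos : 0 < Fintype.card B ^ (t - 1) := Nat.pow_pos hq.le
  have hsum := sum_eval_eq_zero_of_natDegree_lt (pPoly (Fintype.card B) t w αs * f) (by
    have hpd := natDegree_pPoly_le (Fintype.card B) t hq.le w αs
    have hfd := natDegree_le_iff_degree_le.2 hf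
    have := natDegree_mul_le (p := pPoly (Fintype.card B) t w αs) (q := f)
    omega)
  rw [← Finset.sum_sdiff (Finset.subset_univ {αs, αb, αp}),
    Finset.sum_insert (by simp [h1, h3]), Finset.sum_pair h2] at hsum
  simp only [eval_mul, eval_pPoly_self _ t hq ht, hb, hp', zero_mul, add_zero] at hsum
  rw [eq_neg_of_add_eq_zero_right hsum, htr, map_neg, map_neg, map_sum, map_sum]
  congr 1
  refine Finset.sum_congr rfl fun x hx ↦ ?_
  have hne : x - αs ≠ 0 := by
    rw [sub_ne_zero]
    rintro rfl
    simp at hx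
  have hterm : (pPoly (Fintype.card B) t w αs).eval x * f.eval x =
      Algebra.trace B F (w * (x - αs)) • (f.eval x / (x - αs)) := by
    rw [Algebra.smul_def, ← htr, ← eval_pPoly_mul_sub _ t hq.le, mul_assoc, mul_div_cancel₀ _ hne]
  rw [hterm, map_smul, smul_eq_mul, map_mul, htr, htr]
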